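/- Let w ∈ A+_xy. Then: the number of z ∈ A+_xy adjacent to w such that the edge wz has type 0 equals (q−1)·[i]; the number of z ∈ A0_xy adjacent to w such that the edge wz has type + equals (q−1)·[i]; the number of z ∈ A+_xy adjacent to w such that the edge wz has type + equals q·[n−k] − q^i − q; and for every other pair (N, t) with N among A0_xy, A+_xy, A−_xy and t among the types 0, +, −, the number of z ∈ N adjacent to w such that the edge wz has type t equals 0. -/

import Mathlib

open scoped Classical

noncomputable section

variable {F V : Type} [Field F] [AddCommGroup V] [Module F V]

/-- `v` covers `u` in the projective geometry `P`. -/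
def Covers (u v : Submodule F V) : Prop :=
  u ≤ v ∧ Module.finrank F ↥v = Module.finrank F ↥u + 1

/-- `v` slash-covers `u` (relative to the fixed subspace `y`). -/
def SlashCovers (y u v : Submodule F V) : Prop :=
  Covers u v ∧ Module.finrank F ↥(v ⊓ y) = Module.finrank F ↥(u ⊓ y) + 1

/-- `v` backslash-covers `u` (relative to the fixed subspace `y`). -/
def BackslashCovers (y u v : Submodule F V) : Prop :=
  Covers u v ∧ Module.finrank F ↥(v ⊓ y) = Module.finrank F ↥(u ⊓ y)

/-- `q` raised to a real exponent, as a complex number. -/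
def qpow (q : ℕ) (e : ℝ) : ℂ := (((q : ℝ) ^ e : ℝ) : ℂ)

/-- The Gaussian bracket `[m] = (q^m - 1)/(q - 1)` as a rational number. -/
def gaussQ (q m : ℕ) : ℚ := ((q : ℚ) ^ m - 1) / ((q : ℚ) - 1)

/-- The Gaussian bracket `[m] = (q^m - 1)/(q - 1)` as a complex number. -/
def gaussC (q m : ℕ) : ℂ := ((q : ℂ) ^ m - 1) / ((q : ℂ) - 1)

/-- The diagonal matrix `K1`; the `(u,u)` entry is `q^(k/2 - i)` for `u ∈ P_{i,j}`. -/
def matK1 (q k : ℕ) (y : Submodule F V) : Matrix (Submodule F V) (Submodule F V) ℂ :=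
  Matrix.diagonal fun u => qpow q ((k : ℝ) / 2 - (Module.finrank F ↥(u ⊓ y) : ℝ))

/-- The diagonal matrix `K2`; the `(u,u)` entry is `q^(j - (n-k)/2)` for `u ∈ P_{i,j}`. -/
def matK2 (q n k : ℕ) (y : Submodule F V) : Matrix (Submodule F V) (Submodule F V) ℂ :=
  Matrix.diagonal fun u =>
    qpow q (((Module.finrank F ↥u : ℝ) - (Module.finrank F ↥(u ⊓ y) : ℝ))
      - ((n : ℝ) - (k : ℝ)) / 2)

/-- The 0-1 matrix `L1`; the `(u,v)` entry is `1` iff `v` slash-covers `u`. -/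
def matL1 (y : Submodule F V) : Matrix (Submodule F V) (Submodule F V) ℂ :=
  Matrix.of fun u v => if SlashCovers y u v then (1 : ℂ) else 0

/-- The 0-1 matrix `L2`; the `(u,v)` entry is `1` iff `v` backslash-covers `u`. -/
def matL2 (y : Submodule F V) : Matrix (Submodule F V) (Submodule F V) ℂ :=
  Matrix.of fun u v => if BackslashCovers y u v then (1 : ℂ) else 0

/-- `R1 = L1ᵀ`. -/
def matR1 (y : Submodule F V) : Matrix (Submodule F V) (Submodule F V) ℂ := Matrix.transpose (matL1 y)

/-- `R2 = L2ᵀ`. -/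
def matR2 (y : Submodule F V) : Matrix (Submodule F V) (Submodule F V) ℂ := Matrix.transpose (matL2 y)

/-- `R = L1 · R2`. -/
def matR [Fintype (Submodule F V)] (y : Submodule F V) :
    Matrix (Submodule F V) (Submodule F V) ℂ := matL1 y * matR2 y

/-- `L = R1 · L2`. -/
def matL [Fintype (Submodule F V)] (y : Submodule F V) :
    Matrix (Submodule F V) (Submodule F V) ℂ := matR1 y * matL2 y

/-- The 0-1 matrix `F0`. -/
def matF0 (y : Submodule F V) : Matrix (Submodule F V) (Submodule F V) ℂ :=
  Matrix.of fun u v =>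
    if SlashCovers y u (u ⊔ v) ∧ SlashCovers y v (u ⊔ v) ∧
        BackslashCovers y (u ⊓ v) u ∧ BackslashCovers y (u ⊓ v) v then (1 : ℂ) else 0

/-- The 0-1 matrix `F+`. -/
def matFp (y : Submodule F V) : Matrix (Submodule F V) (Submodule F V) ℂ :=
  Matrix.of fun u v =>
    if BackslashCovers y u (u ⊔ v) ∧ BackslashCovers y v (u ⊔ v) then (1 : ℂ) else 0

/-- The 0-1 matrix `F-`. -/
def matFm (y : Submodule F V) : Matrix (Submodule F V) (Submodule F V) ℂ :=
  Matrix.of fun u v =>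
    if SlashCovers y (u ⊓ v) u ∧ SlashCovers y (u ⊓ v) v then (1 : ℂ) else 0

/-- The vertex set `X` of the Grassmann graph: `k`-dimensional subspaces of `V`. -/
abbrev GrassVertex (F V : Type) [Field F] [AddCommGroup V] [Module F V] (k : ℕ) :=
  {z : Submodule F V // Module.finrank F ↥z = k}

/-- The Grassmann graph `J_q(n,k)`: vertices are adjacent iff their intersection
has dimension `k - 1`. -/
def Grass (F V : Type) [Field F] [AddCommGroup V] [Module F V] (k : ℕ) :
    SimpleGraph (GrassVertex F V k) :=
  SimpleGraph.fromRel fun a b => Module.finrank F ↥(a.1 ⊓ b.1) = k - 1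

/-- `B_xy = {z ∈ Γ(x) : ∂(z,y) = ∂(x,y) + 1}`. -/
def Bset {k : ℕ} (x y : GrassVertex F V k) : Set (GrassVertex F V k) :=
  {z | (Grass F V k).Adj x z ∧ (Grass F V k).dist z y = (Grass F V k).dist x y + 1}

/-- `C_xy = {z ∈ Γ(x) : ∂(z,y) = ∂(x,y) - 1}`. -/
def Cset {k : ℕ} (x y : GrassVertex F V k) : Set (GrassVertex F V k) :=
  {z | (Grass F V k).Adj x z ∧ (Grass F V k).dist z y = (Grass F V k).dist x y - 1}

/-- `A_xy = {z ∈ Γ(x) : ∂(z,y) = ∂(x,y)}`. -/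
def Aset {k : ℕ} (x y : GrassVertex F V k) : Set (GrassVertex F V k) :=
  {z | (Grass F V k).Adj x z ∧ (Grass F V k).dist z y = (Grass F V k).dist x y}

/-- `A0_xy`. -/
def A0set {k : ℕ} (x y : GrassVertex F V k) : Set (GrassVertex F V k) :=
  {z | (Grass F V k).Adj x z ∧
    SlashCovers y.1 z.1 (z.1 ⊔ x.1) ∧ SlashCovers y.1 x.1 (z.1 ⊔ x.1) ∧
    BackslashCovers y.1 (z.1 ⊓ x.1) z.1 ∧ BackslashCovers y.1 (z.1 ⊓ x.1) x.1}

/-- `A+_xy`. -/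
def Apset {k : ℕ} (x y : GrassVertex F V k) : Set (GrassVertex F V k) :=
  {z | (Grass F V k).Adj x z ∧
    BackslashCovers y.1 z.1 (z.1 ⊔ x.1) ∧ BackslashCovers y.1 x.1 (z.1 ⊔ x.1)}

/-- `A-_xy`. -/
def Amset {k : ℕ} (x y : GrassVertex F V k) : Set (GrassVertex F V k) :=
  {z | (Grass F V k).Adj x z ∧
    SlashCovers y.1 (z.1 ⊓ x.1) z.1 ∧ SlashCovers y.1 (z.1 ⊓ x.1) x.1}

/-- The edge `wz` has type `0`. -/
def EdgeType0 {k : ℕ} (y w z : GrassVertex F V k) : Prop :=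
  SlashCovers y.1 w.1 (w.1 ⊔ z.1) ∧ SlashCovers y.1 z.1 (w.1 ⊔ z.1) ∧
  BackslashCovers y.1 (w.1 ⊓ z.1) w.1 ∧ BackslashCovers y.1 (w.1 ⊓ z.1) z.1

/-- The edge `wz` has type `+`. -/
def EdgeTypeP {k : ℕ} (y w z : GrassVertex F V k) : Prop :=
  BackslashCovers y.1 w.1 (w.1 ⊔ z.1) ∧ BackslashCovers y.1 z.1 (w.1 ⊔ z.1)

/-- The edge `wz` has type `-`. -/
def EdgeTypeM {k : ℕ} (y w z : GrassVertex F V k) : Prop :=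
  SlashCovers y.1 (w.1 ⊓ z.1) w.1 ∧ SlashCovers y.1 (w.1 ⊓ z.1) z.1

open Module

section Counting

variable {K M : Type*} [Field K] [AddCommGroup M] [Module K M]

theorem map_subtype_submoduleOf {U T : Submodule K M} (hUT : U ≤ T) :
    (U.submoduleOf T).map T.subtype = U := by
  rw [Submodule.submoduleOf, Submodule.map_comap_subtype, inf_eq_right.2 hUT]

theorem submoduleOf_map_subtype {T : Submodule K M} (p : Submodule K T) :
    (p.map T.subtype).submoduleOf T = p :=
  Submodule.comap_map_eq_of_injective T.subtype_injective p

theorem card_points [Finite K] :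
    Nat.card {p : Submodule K M // finrank K p = 1} =
      ∑ j ∈ Finset.range (finrank K M), Nat.card K ^ j := by
  rw [← Projectivization.card_of_finrank K M rfl]
  exact Nat.card_congr (Projectivization.equivSubmodule K M).symm

variable [FiniteDimensional K M]

theorem finrank_comap_mkQ (p : Submodule K M) (q : Submodule K (M ⧸ p)) :
    finrank K (q.comap p.mkQ) = finrank K q + finrank K p := by
  have h := Submodule.finrank_quotient_add_finrank (p.submoduleOf (q.comap p.mkQ))
  have hp : p ≤ q.comap p.mkQ := Submodule.le_comap_mkQ p q
  have h1 : finrank K (p.submoduleOf (q.comap p.mkQ)) = finrank K p :=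
    (Submodule.submoduleOfEquivOfLe hp).finrank_eq
  have h2 := LinearMap.finrank_range_add_finrank_ker (p.mkQ.domRestrict (q.comap p.mkQ))
  rw [LinearMap.range_domRestrict, Submodule.map_comap_eq_of_surjective p.mkQ_surjective,
    LinearMap.ker_domRestrict, Submodule.ker_mkQ] at h2
  rw [← h2, ← h1]
  rfl

/-- Subspaces in the interval `[U, T]` correspond to subspaces of `T / U`. -/
def intervalEquiv {U T : Submodule K M} (hUT : U ≤ T) (r : ℕ) :
    {p : Submodule K (T ⧸ U.submoduleOf T) // finrank K p = r} ≃
      {z : Submodule K M // U ≤ z ∧ z ≤ T ∧ finrank K z = finrank K U + r} where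
  toFun p := ⟨(p.1.comap (U.submoduleOf T).mkQ).map T.subtype, by
    refine ⟨?_, Submodule.map_subtype_le _ _, ?_⟩
    · have h := Submodule.map_mono (f := T.subtype) (Submodule.le_comap_mkQ (U.submoduleOf T) p.1)
      rwa [map_subtype_submoduleOf hUT] at h
    · rw [Submodule.finrank_map_subtype_eq, finrank_comap_mkQ, p.2, add_comm,
        (Submodule.submoduleOfEquivOfLe hUT).finrank_eq]⟩
  invFun z := ⟨(z.1.submoduleOf T).map (U.submoduleOf T).mkQ, by
    have h := finrank_comap_mkQ (U.submoduleOf T)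
      ((z.1.submoduleOf T).map (U.submoduleOf T).mkQ)
    rw [Submodule.comap_map_mkQ, sup_eq_right.2 (Submodule.comap_mono z.2.1),
      (Submodule.submoduleOfEquivOfLe hUT).finrank_eq,
      (Submodule.submoduleOfEquivOfLe z.2.2.1).finrank_eq, z.2.2.2] at h
    omega⟩
  left_inv p := by
    ext1
    dsimp only
    rw [submoduleOf_map_subtype,
      Submodule.map_comap_eq_of_surjective (Submodule.mkQ_surjective _)]
  right_inv z := by
    ext1
    dsimp only
    rw [Submodule.comap_map_mkQ, sup_eq_right.2 (Submodule.comap_mono z.2.1),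
      map_subtype_submoduleOf z.2.2.1]

theorem card_hyperplanes [Finite K] :
    Nat.card {p : Submodule K M // finrank K p + 1 = finrank K M} =
      ∑ j ∈ Finset.range (finrank K M), Nat.card K ^ j := by
  rw [← Subspace.dual_finrank_eq (K := K) (V := M), ← card_points]
  refine Nat.card_congr ((Subspace.orderIsoFiniteDimensional (K := K) (V := M)).toEquiv.trans
    OrderDual.ofDual |>.subtypeEquiv fun p => ?_)
  have h := Subspace.finrank_add_finrank_dualAnnihilator_eq p
  change _ ↔ finrank K p.dualAnnihilator = 1
  rw [Subspace.dual_finrank_eq]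
  omega

theorem finrank_interval {U T : Submodule K M} (hUT : U ≤ T) :
    finrank K (T ⧸ U.submoduleOf T) = finrank K T - finrank K U := by
  have h := Submodule.finrank_quotient_add_finrank (U.submoduleOf T)
  rw [(Submodule.submoduleOfEquivOfLe hUT).finrank_eq] at h
  omega

theorem card_interval_points [Finite K] {U T : Submodule K M} (hUT : U ≤ T) :
    Nat.card {z : Submodule K M // U ≤ z ∧ z ≤ T ∧ finrank K z = finrank K U + 1} =
      ∑ j ∈ Finset.range (finrank K T - finrank K U), Nat.card K ^ j := by
  rw [← finrank_interval hUT, ← card_points]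
  exact Nat.card_congr (intervalEquiv hUT 1).symm

theorem card_interval_hyperplanes [Finite K] {U T : Submodule K M} (hUT : U < T) :
    Nat.card {z : Submodule K M // U ≤ z ∧ z ≤ T ∧ finrank K z + 1 = finrank K T} =
      ∑ j ∈ Finset.range (finrank K T - finrank K U), Nat.card K ^ j := by
  have h := Submodule.finrank_lt_finrank_of_lt hUT
  rw [← finrank_interval hUT.le, ← card_hyperplanes, finrank_interval hUT.le]
  refine (Nat.card_congr (Equiv.trans (Equiv.subtypeEquivRight fun p => ?_)
    ((intervalEquiv hUT.le (finrank K T - finrank K U - 1)).trans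
      (Equiv.subtypeEquivRight fun z => ?_)))).symm
  · omega
  · refine and_congr_right fun _ => and_congr_right fun _ => ?_
    omega

end Counting

section Grassmann

variable {k : ℕ}

theorem grass_adj_iff (hk : 0 < k) (a b : GrassVertex F V k) :
    (Grass F V k).Adj a b ↔ a ≠ b ∧ finrank F ↥(a.1 ⊓ b.1) + 1 = k := by
  rw [Grass, SimpleGraph.fromRel_adj, inf_comm b.1 a.1, or_self]
  refine and_congr_right fun _ => ?_
  omega

theorem inf_covers_of_adj (hk : 0 < k) {a b : GrassVertex F V k} (h : (Grass F V k).Adj a b) :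
    Covers (a.1 ⊓ b.1) a.1 ∧ Covers (a.1 ⊓ b.1) b.1 := by
  have h1 := ((grass_adj_iff hk a b).1 h).2
  exact ⟨⟨inf_le_left, by rw [h1, a.2]⟩, ⟨inf_le_right, by rw [h1, b.2]⟩⟩

variable [FiniteDimensional F V]

theorem vertex_eq_of_le {a b : GrassVertex F V k} (h : a.1 ≤ b.1) : a = b :=
  Subtype.ext (Submodule.eq_of_le_of_finrank_eq h (a.2.trans b.2.symm))

theorem grass_adj_of_le {a b : GrassVertex F V k} {U : Submodule F V} (hab : a ≠ b)
    (hU : finrank F U + 1 = k) (ha : U ≤ a.1) (hb : U ≤ b.1) : (Grass F V k).Adj a b := by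
  rw [grass_adj_iff (by omega)]
  refine ⟨hab, ?_⟩
  have h1 := Submodule.finrank_mono (le_inf ha hb)
  have h2 : a.1 ⊓ b.1 < a.1 := inf_lt_left.2 fun h => hab (vertex_eq_of_le h)
  have h3 := Submodule.finrank_lt_finrank_of_lt h2
  have := a.2
  omega

theorem grass_adj_of_ge {a b : GrassVertex F V k} {T : Submodule F V} (hk : 0 < k) (hab : a ≠ b)
    (hT : finrank F T = k + 1) (ha : a.1 ≤ T) (hb : b.1 ≤ T) : (Grass F V k).Adj a b := by
  rw [grass_adj_iff hk]
  refine ⟨hab, ?_⟩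
  have h1 := Submodule.finrank_mono (sup_le ha hb)
  have h2 : a.1 ⊓ b.1 < a.1 := inf_lt_left.2 fun h => hab (vertex_eq_of_le h)
  have h3 := Submodule.finrank_lt_finrank_of_lt h2
  have h4 := Submodule.finrank_sup_add_finrank_inf_eq a.1 b.1
  have := a.2
  have := b.2
  omega

theorem finrank_sup_of_adj (hk : 0 < k) {a b : GrassVertex F V k} (h : (Grass F V k).Adj a b) :
    finrank F ↥(a.1 ⊔ b.1) = k + 1 := by
  have h1 := ((grass_adj_iff hk a b).1 h).2
  have h2 := Submodule.finrank_sup_add_finrank_inf_eq a.1 b.1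
  have := a.2
  have := b.2
  omega

theorem finrank_inf_le_of_adj (hk : 0 < k) {a c : GrassVertex F V k} (b : GrassVertex F V k)
    (h : (Grass F V k).Adj a c) : finrank F ↥(c.1 ⊓ b.1) ≤ finrank F ↥(a.1 ⊓ b.1) + 1 := by
  have h1 := ((grass_adj_iff hk a c).1 h).2
  have h2 := Submodule.finrank_sup_add_finrank_inf_eq (c.1 ⊓ b.1) (a.1 ⊓ c.1)
  have h3 := Submodule.finrank_mono
    (sup_le (inf_le_left : c.1 ⊓ b.1 ≤ c.1) (inf_le_right : a.1 ⊓ c.1 ≤ c.1))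
  have h4 : (c.1 ⊓ b.1) ⊓ (a.1 ⊓ c.1) ≤ a.1 ⊓ b.1 :=
    le_inf (inf_le_right.trans inf_le_left) (inf_le_left.trans inf_le_right)
  have h5 := Submodule.finrank_mono h4
  have := c.2
  omega

theorem le_length_add_finrank_inf (hk : 0 < k) {a b : GrassVertex F V k}
    (p : (Grass F V k).Walk a b) : k ≤ p.length + finrank F ↥(a.1 ⊓ b.1) := by
  induction p with
  | @nil c =>
    rw [inf_idem, c.2]
    omega
  | @cons a c b h p ih =>
    have := finrank_inf_le_of_adj hk b h
    rw [SimpleGraph.Walk.length_cons]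
    omega

theorem exists_walk_length [Finite F] (m : ℕ) : ∀ a b : GrassVertex F V k,
    finrank F ↥(a.1 ⊓ b.1) + m = k → ∃ p : (Grass F V k).Walk a b, p.length = m := by
  induction m with
  | zero =>
    intro a b h
    have h1 : a.1 ⊓ b.1 = a.1 :=
      Submodule.eq_of_le_of_finrank_eq inf_le_left (by have := a.2; omega)
    obtain rfl : a = b := vertex_eq_of_le (inf_eq_left.1 h1)
    exact ⟨.nil, rfl⟩
  | succ m ih =>
    intro a b h
    have hpos : 0 < ∑ j ∈ Finset.range (m + 1), Nat.card F ^ j := by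
      rw [Finset.sum_range_succ']
      simp
    have ha : a.1 ⊓ b.1 < a.1 := by
      refine lt_of_le_of_ne inf_le_left fun h' => ?_
      rw [h', a.2] at h
      omega
    have hH := card_interval_hyperplanes ha
    have hC := card_interval_points (inf_le_right : a.1 ⊓ b.1 ≤ b.1)
    rw [show finrank F a.1 - finrank F ↥(a.1 ⊓ b.1) = m + 1 by have := a.2; omega] at hH
    rw [show finrank F b.1 - finrank F ↥(a.1 ⊓ b.1) = m + 1 by have := b.2; omega] at hC
    obtain ⟨⟨H, hH1, hH2, hH3⟩⟩ := (Nat.card_pos_iff.1 (hH ▸ hpos)).1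
    obtain ⟨⟨C, hC1, hC2, hC3⟩⟩ := (Nat.card_pos_iff.1 (hC ▸ hpos)).1
    have hHC : H ⊓ C = a.1 ⊓ b.1 := le_antisymm (inf_le_inf hH2 hC2) (le_inf hH1 hC1)
    have h1 := Submodule.finrank_sup_add_finrank_inf_eq H C
    rw [hHC] at h1
    have hak := a.2
    have hbk := b.2
    let c : GrassVertex F V k := ⟨H ⊔ C, by omega⟩
    have hCc : C ≤ c.1 ⊓ b.1 := le_inf le_sup_right hC2
    have hac : a ≠ c := by
      rintro hac
      have h2 : C ≤ a.1 ⊓ b.1 := by rwa [← hac] at hCc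
      have h3 := Submodule.finrank_mono h2
      omega
    have hadj : (Grass F V k).Adj a c := grass_adj_of_le hac (by omega) hH2 le_sup_left
    have h3 := Submodule.finrank_mono hCc
    have h4 := finrank_inf_le_of_adj (by omega) b hadj
    obtain ⟨p, hp⟩ := ih c b (by omega)
    exact ⟨.cons hadj p, by rw [SimpleGraph.Walk.length_cons, hp]⟩

/-- The distance in the Grassmann graph. -/
theorem grass_dist_add_finrank_inf [Finite F] (hk : 0 < k) (a b : GrassVertex F V k) :
    (Grass F V k).dist a b + finrank F ↥(a.1 ⊓ b.1) = k := by
  have h1 := Submodule.finrank_mono (inf_le_left : a.1 ⊓ b.1 ≤ a.1)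
  have := a.2
  obtain ⟨p, hp⟩ := exists_walk_length (k - finrank F ↥(a.1 ⊓ b.1)) a b (by omega)
  have h2 := SimpleGraph.dist_le p
  obtain ⟨p', hp'⟩ := p.reachable.exists_walk_length_eq_dist
  have h3 := le_length_add_finrank_inf hk p'
  omega

variable {y a b : GrassVertex F V k}

theorem covers_sup_of_adj (hk : 0 < k) (h : (Grass F V k).Adj a b) :
    Covers a.1 (a.1 ⊔ b.1) ∧ Covers b.1 (a.1 ⊔ b.1) := by
  have h1 := finrank_sup_of_adj hk h
  exact ⟨⟨le_sup_left, by rw [h1, a.2]⟩, ⟨le_sup_right, by rw [h1, b.2]⟩⟩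

theorem sup_eq_sup_of_finrank_le {a b y T : Submodule F V} (ha : a ≤ T) (hb : b ≤ T)
    (hTa : finrank F ↥(T ⊔ y) ≤ finrank F ↥(a ⊔ y))
    (hTb : finrank F ↥(T ⊔ y) ≤ finrank F ↥(b ⊔ y)) : a ⊔ y = b ⊔ y :=
  (Submodule.eq_of_le_of_finrank_le (sup_le_sup_right ha y) hTa).trans
    (Submodule.eq_of_le_of_finrank_le (sup_le_sup_right hb y) hTb).symm

theorem inf_eq_inf_of_finrank_le {a b y U : Submodule F V} (ha : U ≤ a) (hb : U ≤ b)
    (hUa : finrank F ↥(a ⊓ y) ≤ finrank F ↥(U ⊓ y))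
    (hUb : finrank F ↥(b ⊓ y) ≤ finrank F ↥(U ⊓ y)) : a ⊓ y = b ⊓ y :=
  (Submodule.eq_of_le_of_finrank_le (inf_le_inf_right y ha) hUa).symm.trans
    (Submodule.eq_of_le_of_finrank_le (inf_le_inf_right y hb) hUb)

theorem edgeType0_iff (hk : 0 < k) (h : (Grass F V k).Adj a b) :
    EdgeType0 y a b ↔ a.1 ⊓ y.1 = b.1 ⊓ y.1 ∧ a.1 ⊔ y.1 = b.1 ⊔ y.1 := by
  have hs := finrank_sup_of_adj hk h
  have e1 := Submodule.finrank_sup_add_finrank_inf_eq a.1 y.1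
  have e2 := Submodule.finrank_sup_add_finrank_inf_eq b.1 y.1
  have e3 := Submodule.finrank_sup_add_finrank_inf_eq (a.1 ⊔ b.1) y.1
  have ha := a.2
  have hb := b.2
  constructor
  · rintro ⟨⟨-, h1⟩, ⟨-, h2⟩, ⟨-, h3⟩, ⟨-, h4⟩⟩
    exact ⟨inf_eq_inf_of_finrank_le inf_le_left inf_le_right h3.le h4.le,
      sup_eq_sup_of_finrank_le (T := a.1 ⊔ b.1) le_sup_left le_sup_right (by omega) (by omega)⟩
  · rintro ⟨h1, h2⟩
    have h3 : a.1 ⊓ b.1 ⊓ y.1 = b.1 ⊓ y.1 := by rw [inf_inf_distrib_right, h1, inf_idem]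
    have h4 : a.1 ⊔ b.1 ⊔ y.1 = b.1 ⊔ y.1 := by rw [sup_sup_distrib_right, h2, sup_idem]
    rw [h4] at e3
    rw [h1, h2] at e1
    refine ⟨⟨(covers_sup_of_adj hk h).1, ?_⟩, ⟨(covers_sup_of_adj hk h).2, ?_⟩,
      ⟨(inf_covers_of_adj hk h).1, ?_⟩, ⟨(inf_covers_of_adj hk h).2, ?_⟩⟩
    · rw [h1]; omega
    · omega
    · rw [h1, h3]
    · rw [h3]

theorem sup_inf_eq_of_edgeTypeP (h : EdgeTypeP y a b) : (a.1 ⊔ b.1) ⊓ y.1 = a.1 ⊓ y.1 :=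
  (Submodule.eq_of_le_of_finrank_le (inf_le_inf_right _ le_sup_left) h.1.2.le).symm

theorem edgeTypeP_iff (hk : 0 < k) (h : (Grass F V k).Adj a b) :
    EdgeTypeP y a b ↔ a.1 ⊓ y.1 = b.1 ⊓ y.1 ∧ a.1 ⊔ y.1 ≠ b.1 ⊔ y.1 := by
  have hs := finrank_sup_of_adj hk h
  have e1 := Submodule.finrank_sup_add_finrank_inf_eq a.1 y.1
  have e2 := Submodule.finrank_sup_add_finrank_inf_eq b.1 y.1
  have e3 := Submodule.finrank_sup_add_finrank_inf_eq (a.1 ⊔ b.1) y.1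
  have ha := a.2
  have hb := b.2
  constructor
  · rintro ⟨⟨-, h1⟩, ⟨-, h2⟩⟩
    refine ⟨?_, fun h3 => ?_⟩
    · exact (Submodule.eq_of_le_of_finrank_le (inf_le_inf_right _ le_sup_left) h1.le).trans
        (Submodule.eq_of_le_of_finrank_le (inf_le_inf_right _ le_sup_right) h2.le).symm
    · rw [sup_sup_distrib_right, h3, sup_idem] at e3
      omega
  · rintro ⟨h1, h2⟩
    have hi := Submodule.finrank_mono (inf_le_inf_right y.1 (le_sup_left : a.1 ≤ a.1 ⊔ b.1))
    have hab : finrank F ↥(a.1 ⊓ y.1) = finrank F ↥(b.1 ⊓ y.1) := by rw [h1]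
    have key : finrank F ↥((a.1 ⊔ b.1) ⊓ y.1) ≤ finrank F ↥(a.1 ⊓ y.1) := by
      by_contra hc
      exact h2 (sup_eq_sup_of_finrank_le (T := a.1 ⊔ b.1) le_sup_left le_sup_right
        (by omega) (by omega))
    exact ⟨⟨(covers_sup_of_adj hk h).1, by omega⟩, ⟨(covers_sup_of_adj hk h).2, by omega⟩⟩

theorem inf_ne_and_sup_eq_of_edgeTypeM (hk : 0 < k) (h : (Grass F V k).Adj a b)
    (hM : EdgeTypeM y a b) : a.1 ⊓ y.1 ≠ b.1 ⊓ y.1 ∧ a.1 ⊔ y.1 = b.1 ⊔ y.1 := by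
  have hs := finrank_sup_of_adj hk h
  have e1 := Submodule.finrank_sup_add_finrank_inf_eq a.1 y.1
  have e2 := Submodule.finrank_sup_add_finrank_inf_eq b.1 y.1
  have e3 := Submodule.finrank_sup_add_finrank_inf_eq (a.1 ⊔ b.1) y.1
  have e4 := Submodule.finrank_sup_add_finrank_inf_eq (a.1 ⊓ y.1) (b.1 ⊓ y.1)
  have ha := a.2
  have hb := b.2
  obtain ⟨⟨-, h1⟩, ⟨-, h2⟩⟩ := hM
  rw [inf_inf_distrib_right] at h1 h2
  refine ⟨fun h3 => ?_, ?_⟩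
  · rw [h3, inf_idem] at h2
    omega
  · have h4 := Submodule.finrank_mono (sup_le (inf_le_inf_right y.1 le_sup_left)
      (inf_le_inf_right y.1 le_sup_right) :
        a.1 ⊓ y.1 ⊔ b.1 ⊓ y.1 ≤ (a.1 ⊔ b.1) ⊓ y.1)
    exact sup_eq_sup_of_finrank_le (T := a.1 ⊔ b.1) le_sup_left le_sup_right (by omega) (by omega)

/-- Three pairwise adjacent vertices have a common hyperplane, or span a `k + 1`-space. -/
theorem inf_le_or_le_sup (hk : 0 < k) {x w z : GrassVertex F V k} (hxw : (Grass F V k).Adj x w)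
    (hxz : (Grass F V k).Adj x z) (hwz : (Grass F V k).Adj w z) :
    x.1 ⊓ w.1 ≤ z.1 ∨ z.1 ≤ x.1 ⊔ w.1 := by
  have h1 := ((grass_adj_iff hk _ _).1 hxw).2
  have h2 := ((grass_adj_iff hk _ _).1 hxz).2
  have h3 := ((grass_adj_iff hk _ _).1 hwz).2
  have h4 := Submodule.finrank_sup_add_finrank_inf_eq (x.1 ⊓ z.1) (w.1 ⊓ z.1)
  have h5 := Submodule.finrank_mono
    (le_inf (inf_le_left.trans inf_le_left) (inf_le_right.trans inf_le_left) :
      (x.1 ⊓ z.1) ⊓ (w.1 ⊓ z.1) ≤ x.1 ⊓ w.1)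
  have hle : x.1 ⊓ z.1 ⊔ w.1 ⊓ z.1 ≤ z.1 := sup_le inf_le_right inf_le_right
  have h6 := Submodule.finrank_mono hle
  have hz := z.2
  by_cases hc : finrank F ↥((x.1 ⊓ z.1) ⊓ (w.1 ⊓ z.1)) + 1 = k
  · left
    have h7 : (x.1 ⊓ z.1) ⊓ (w.1 ⊓ z.1) = x.1 ⊓ w.1 :=
      Submodule.eq_of_le_of_finrank_le
        (le_inf (inf_le_left.trans inf_le_left) (inf_le_right.trans inf_le_left)) (by omega)
    rw [← h7]
    exact inf_le_left.trans inf_le_right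
  · right
    have h8 := Submodule.finrank_mono (inf_le_left : (x.1 ⊓ z.1) ⊓ (w.1 ⊓ z.1) ≤ x.1 ⊓ z.1)
    have h7 : x.1 ⊓ z.1 ⊔ w.1 ⊓ z.1 = z.1 := Submodule.eq_of_le_of_finrank_le hle (by omega)
    rw [← h7]
    exact sup_le_sup inf_le_left inf_le_left

theorem ncard_between_points [Finite F] {U T : Submodule F V} (hU : finrank F U + 1 = k)
    (hUT : U ≤ T) : {z : GrassVertex F V k | U ≤ z.1 ∧ z.1 ≤ T}.ncard =
      ∑ j ∈ Finset.range (finrank F T - finrank F U), Nat.card F ^ j := by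
  rw [← card_interval_points hUT, ← Nat.card_coe_set_eq]
  exact Nat.card_congr
    { toFun := fun z => ⟨z.1.1, z.2.1, z.2.2, z.1.2.trans hU.symm⟩
      invFun := fun z => ⟨⟨z.1, z.2.2.2.trans hU⟩, z.2.1, z.2.2.1⟩ }

theorem ncard_between_hyperplanes [Finite F] {U T : Submodule F V} (hT : finrank F T = k + 1)
    (hUT : U < T) : {z : GrassVertex F V k | U ≤ z.1 ∧ z.1 ≤ T}.ncard =
      ∑ j ∈ Finset.range (finrank F T - finrank F U), Nat.card F ^ j := by
  rw [← card_interval_hyperplanes hUT, ← Nat.card_coe_set_eq]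
  exact Nat.card_congr
    { toFun := fun z => ⟨z.1.1, z.2.1, z.2.2, by rw [z.1.2, hT]⟩
      invFun := fun z => ⟨⟨z.1, by have := z.2.2.2; omega⟩, z.2.1, z.2.2.1⟩ }

theorem le_sup_iff_inf_ne {z : GrassVertex F V k} {U y : Submodule F V}
    (hU : finrank F U + 1 = k) (hUz : U ≤ z.1) : z.1 ≤ U ⊔ y ↔ U ⊓ y ≠ z.1 ⊓ y := by
  have e1 := Submodule.finrank_sup_add_finrank_inf_eq U y
  have e2 := Submodule.finrank_sup_add_finrank_inf_eq z.1 y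
  have hz := z.2
  constructor
  · intro h1 h2
    have h3 : z.1 ⊔ y = U ⊔ y :=
      le_antisymm (sup_le h1 le_sup_right) (sup_le_sup_right hUz y)
    rw [h3, ← h2] at e2
    omega
  · intro h1
    have h2 := Submodule.finrank_lt_finrank_of_lt (lt_of_le_of_ne (inf_le_inf_right y hUz) h1)
    rw [Submodule.eq_of_le_of_finrank_le (sup_le_sup_right hUz y) (by omega)]
    exact le_sup_left

theorem sup_eq_of_le_sup {y : Submodule F V} (hab : a.1 ⊓ y = b.1 ⊓ y) (h : b.1 ≤ a.1 ⊔ y) :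
    a.1 ⊔ y = b.1 ⊔ y := by
  have e1 := Submodule.finrank_sup_add_finrank_inf_eq a.1 y
  have e2 := Submodule.finrank_sup_add_finrank_inf_eq b.1 y
  have ha := a.2
  have hb := b.2
  rw [hab] at e1
  exact (Submodule.eq_of_le_of_finrank_le (sup_le h le_sup_right) (by omega)).symm

variable {x w : GrassVertex F V k} {i : ℕ}

theorem ncard_same_sup [Finite F] [Finite (Submodule F V)] (hk : 0 < k)
    (hxw : (Grass F V k).Adj x w) (hi : finrank F ↥(x.1 ⊓ y.1) + i = k)
    (hinf : x.1 ⊓ y.1 = w.1 ⊓ y.1) (hsup : x.1 ⊔ y.1 ≠ w.1 ⊔ y.1) :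
    {z | (Grass F V k).Adj x z ∧ (Grass F V k).Adj w z ∧
      x.1 ⊓ y.1 = z.1 ⊓ y.1 ∧ x.1 ⊔ y.1 = z.1 ⊔ y.1}.ncard + 1 = Nat.card F ^ i := by
  set E := {z | (Grass F V k).Adj x z ∧ (Grass F V k).Adj w z ∧
      x.1 ⊓ y.1 = z.1 ⊓ y.1 ∧ x.1 ⊔ y.1 = z.1 ⊔ y.1}
  set U := x.1 ⊓ w.1 with hUdef
  have hU : finrank F U + 1 = k := ((grass_adj_iff hk _ _).1 hxw).2
  have hUx : U ≤ x.1 := inf_le_left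
  have hUy : U ⊓ y.1 = x.1 ⊓ y.1 := by rw [hUdef, inf_inf_distrib_right, ← hinf, inf_idem]
  have hmem : ∀ z ∈ E, U ≤ z.1 := by
    rintro z ⟨h1, h2, h3, h4⟩
    refine (inf_le_or_le_sup hk hxw h1 h2).resolve_right fun h5 => hsup ?_
    refine sup_eq_of_le_sup hinf ?_
    have h6 : x.1 ⊔ z.1 = x.1 ⊔ w.1 := Submodule.eq_of_le_of_finrank_eq (sup_le le_sup_left h5)
      (by rw [finrank_sup_of_adj hk h1, finrank_sup_of_adj hk hxw])
    calc w.1 ≤ x.1 ⊔ w.1 := le_sup_right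
      _ = x.1 ⊔ z.1 := h6.symm
      _ ≤ x.1 ⊔ y.1 := sup_le le_sup_left (h4 ▸ le_sup_left)
  have hx : ¬ x.1 ≤ U ⊔ y.1 := by
    rw [le_sup_iff_inf_ne hU hUx]
    exact fun h => h hUy
  have hunion : {z : GrassVertex F V k | U ≤ z.1 ∧ z.1 ≤ x.1 ⊔ y.1} =
      E ∪ {x} ∪ {z : GrassVertex F V k | U ≤ z.1 ∧ z.1 ≤ U ⊔ y.1} := by
    ext z
    simp only [Set.mem_ofPred_eq, Set.mem_union, Set.mem_singleton_iff]
    constructor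
    · rintro ⟨h1, h2⟩
      by_cases h3 : z.1 ≤ U ⊔ y.1
      · exact Or.inr ⟨h1, h3⟩
      by_cases h4 : z = x
      · exact Or.inl (Or.inr h4)
      have h5 : x.1 ⊓ y.1 = z.1 ⊓ y.1 := by
        rw [le_sup_iff_inf_ne hU h1, not_not] at h3
        rw [← hUy, h3]
      have h6 := sup_eq_of_le_sup h5 h2
      have h7 : w ≠ z := by
        rintro rfl
        exact hsup h6
      exact Or.inl (Or.inl ⟨grass_adj_of_le (Ne.symm h4) hU hUx h1,
        grass_adj_of_le h7 hU inf_le_right h1, h5, h6⟩)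
    · rintro ((h | rfl) | ⟨h1, h2⟩)
      · exact ⟨hmem z h, h.2.2.2 ▸ le_sup_left⟩
      · exact ⟨hUx, le_sup_left⟩
      · exact ⟨h1, h2.trans (sup_le_sup_right hUx _)⟩
  have hcard := congrArg Set.ncard hunion
  rw [Set.ncard_union_eq, Set.ncard_union_eq, Set.ncard_singleton,
    ncard_between_points hU (hUx.trans le_sup_left), ncard_between_points hU le_sup_left] at hcard
  · have e1 := Submodule.finrank_sup_add_finrank_inf_eq x.1 y.1
    have e2 := Submodule.finrank_sup_add_finrank_inf_eq U y.1
    rw [hUy] at e2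
    have := x.2
    have := y.2
    rw [show finrank F ↥(x.1 ⊔ y.1) - finrank F U = i + 1 by omega,
      show finrank F ↥(U ⊔ y.1) - finrank F U = i by omega, Finset.sum_range_succ] at hcard
    omega
  · rw [Set.disjoint_singleton_right]
    exact fun h => h.1.ne rfl
  · rw [Set.disjoint_left]
    rintro z (h | rfl) ⟨h1, h2⟩
    · rw [le_sup_iff_inf_ne hU h1] at h2
      exact h2 (hUy.trans h.2.2.1)
    · exact hx h2

theorem ncard_same_inf [Finite F] [Finite (Submodule F V)] (hk : 0 < k)
    (hxw : (Grass F V k).Adj x w) (hi : finrank F ↥(x.1 ⊓ y.1) + i = k)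
    (hinf : x.1 ⊓ y.1 = w.1 ⊓ y.1) (hsup : (x.1 ⊔ w.1) ⊓ y.1 = x.1 ⊓ y.1) :
    {z | (Grass F V k).Adj x z ∧ (Grass F V k).Adj w z ∧ x.1 ⊓ y.1 = z.1 ⊓ y.1}.ncard
        + Nat.card F + 3 =
      ∑ j ∈ Finset.range (finrank F V - k + 1), Nat.card F ^ j + Nat.card F ^ i := by
  set S := {z | (Grass F V k).Adj x z ∧ (Grass F V k).Adj w z ∧ x.1 ⊓ y.1 = z.1 ⊓ y.1}
  set U := x.1 ⊓ w.1 with hUdef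
  have hU : finrank F U + 1 = k := ((grass_adj_iff hk _ _).1 hxw).2
  have hUx : U ≤ x.1 := inf_le_left
  have hUw : U ≤ w.1 := inf_le_right
  have hUy : U ⊓ y.1 = x.1 ⊓ y.1 := by rw [hUdef, inf_inf_distrib_right, ← hinf, inf_idem]
  have hDU : x.1 ⊓ y.1 ≤ U := hUy ▸ inf_le_left
  have hT := finrank_sup_of_adj hk hxw
  have hxk := x.2
  have hyk := y.2
  have hpts : {z : GrassVertex F V k | U ≤ z.1 ∧ z.1 ≤ ⊤} =
      S ∩ {z | U ≤ z.1} ∪ {x, w} ∪ {z : GrassVertex F V k | U ≤ z.1 ∧ z.1 ≤ U ⊔ y.1} := by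
    ext z
    simp only [Set.mem_ofPred_eq, Set.mem_union, Set.mem_insert_iff, Set.mem_singleton_iff,
      Set.mem_inter_iff]
    constructor
    · rintro ⟨h1, -⟩
      by_cases h3 : z.1 ≤ U ⊔ y.1
      · exact Or.inr ⟨h1, h3⟩
      by_cases h4 : z = x ∨ z = w
      · exact Or.inl (Or.inr h4)
      rw [not_or] at h4
      rw [le_sup_iff_inf_ne hU h1, not_not] at h3
      exact Or.inl (Or.inl ⟨⟨grass_adj_of_le (Ne.symm h4.1) hU hUx h1,
        grass_adj_of_le (Ne.symm h4.2) hU hUw h1, hUy.symm.trans h3⟩, h1⟩)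
    · rintro ((⟨-, h⟩ | rfl | rfl) | ⟨h1, -⟩)
      exacts [⟨h, le_top⟩, ⟨hUx, le_top⟩, ⟨hUw, le_top⟩, ⟨h1, le_top⟩]
  have hhyp : {z : GrassVertex F V k | x.1 ⊓ y.1 ≤ z.1 ∧ z.1 ≤ x.1 ⊔ w.1} =
      S \ {z | U ≤ z.1} ∪ {z : GrassVertex F V k | U ≤ z.1 ∧ z.1 ≤ x.1 ⊔ w.1} := by
    ext z
    simp only [Set.mem_ofPred_eq, Set.mem_union, Set.mem_sdiff]
    constructor
    · rintro ⟨h1, h2⟩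
      by_cases h3 : U ≤ z.1
      · exact Or.inr ⟨h3, h2⟩
      have h4 : x ≠ z := by
        rintro rfl
        exact h3 hUx
      have h5 : w ≠ z := by
        rintro rfl
        exact h3 hUw
      exact Or.inl ⟨⟨grass_adj_of_ge hk h4 hT le_sup_left h2,
        grass_adj_of_ge hk h5 hT le_sup_right h2,
        le_antisymm (le_inf h1 inf_le_right) (hsup ▸ inf_le_inf_right _ h2)⟩, h3⟩
    · rintro (⟨⟨h1, h2, h3⟩, h4⟩ | ⟨h1, h2⟩)
      · exact ⟨h3 ▸ inf_le_left, (inf_le_or_le_sup hk hxw h1 h2).resolve_left h4⟩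
      · exact ⟨hDU.trans h1, h2⟩
  have hc1 := congrArg Set.ncard hpts
  have hc2 := congrArg Set.ncard hhyp
  have hc3 := Set.ncard_inter_add_ncard_sdiff_eq_ncard S {z | U ≤ z.1}
  rw [Set.ncard_union_eq, Set.ncard_union_eq, Set.ncard_pair hxw.ne,
    ncard_between_points hU le_top, ncard_between_points hU le_sup_left, finrank_top] at hc1
  · rw [Set.ncard_union_eq, ncard_between_points hU (hUx.trans le_sup_left),
      ncard_between_hyperplanes hT
        (lt_of_le_of_ne (inf_le_left.trans le_sup_left) fun h => by
          have := Submodule.finrank_mono (inf_le_left : x.1 ⊓ y.1 ≤ x.1)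
          rw [h] at this
          omega)] at hc2
    · have e2 := Submodule.finrank_sup_add_finrank_inf_eq U y.1
      rw [hUy] at e2
      have e3 := Submodule.finrank_le x.1
      rw [show finrank F V - finrank F U = finrank F V - k + 1 by omega,
        show finrank F ↥(U ⊔ y.1) - finrank F U = i by omega] at hc1
      rw [show finrank F ↥(x.1 ⊔ w.1) - finrank F ↥(x.1 ⊓ y.1) = i + 1 by omega,
        show finrank F ↥(x.1 ⊔ w.1) - finrank F U = 2 by omega, Finset.sum_range_succ] at hc2
      simp only [Finset.sum_range_succ _ 1, Finset.sum_range_one, pow_zero, pow_one] at hc2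
      omega
    · rw [Set.disjoint_left]
      exact fun z h h1 => h.2 h1.1
  · rw [Set.disjoint_right]
    rintro z (rfl | rfl) ⟨h, -⟩
    exacts [h.1.ne rfl, h.2.1.ne rfl]
  · rw [Set.disjoint_left]
    rintro z (⟨h, -⟩ | rfl | rfl) ⟨h1, h2⟩ <;> rw [le_sup_iff_inf_ne hU h1] at h2
    exacts [h2 (hUy.trans h.2.2), h2 hUy, h2 (hUy.trans hinf)]

theorem ncard_ne_sup [Finite F] [Finite (Submodule F V)] (hk : 0 < k)
    (hxw : (Grass F V k).Adj x w) (hi : finrank F ↥(x.1 ⊓ y.1) + i = k)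
    (hinf : x.1 ⊓ y.1 = w.1 ⊓ y.1) (hne : x.1 ⊔ y.1 ≠ w.1 ⊔ y.1)
    (hsup : (x.1 ⊔ w.1) ⊓ y.1 = x.1 ⊓ y.1) :
    {z | (Grass F V k).Adj x z ∧ (Grass F V k).Adj w z ∧
      x.1 ⊓ y.1 = z.1 ⊓ y.1 ∧ x.1 ⊔ y.1 ≠ z.1 ⊔ y.1 ∧ w.1 ⊔ y.1 ≠ z.1 ⊔ y.1}.ncard
        + Nat.card F ^ i + Nat.card F =
      Nat.card F * ∑ j ∈ Finset.range (finrank F V - k), Nat.card F ^ j := by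
  have h1 := ncard_same_sup hk hxw hi hinf hne
  have h2 := ncard_same_sup hk hxw.symm (hinf ▸ hi) hinf.symm hne.symm
  have h3 := ncard_same_inf hk hxw hi hinf hsup
  rw [geom_sum_succ] at h3
  have hunion : {z | (Grass F V k).Adj x z ∧ (Grass F V k).Adj w z ∧ x.1 ⊓ y.1 = z.1 ⊓ y.1} =
      {z | (Grass F V k).Adj x z ∧ (Grass F V k).Adj w z ∧
        x.1 ⊓ y.1 = z.1 ⊓ y.1 ∧ x.1 ⊔ y.1 ≠ z.1 ⊔ y.1 ∧ w.1 ⊔ y.1 ≠ z.1 ⊔ y.1} ∪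
      ({z | (Grass F V k).Adj x z ∧ (Grass F V k).Adj w z ∧
        x.1 ⊓ y.1 = z.1 ⊓ y.1 ∧ x.1 ⊔ y.1 = z.1 ⊔ y.1} ∪
      {z | (Grass F V k).Adj w z ∧ (Grass F V k).Adj x z ∧
        w.1 ⊓ y.1 = z.1 ⊓ y.1 ∧ w.1 ⊔ y.1 = z.1 ⊔ y.1}) := by
    ext z
    simp only [Set.mem_ofPred_eq, Set.mem_union, ← hinf]
    tauto
  rw [hunion, Set.ncard_union_eq, Set.ncard_union_eq] at h3
  · omega
  · rw [Set.disjoint_left]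
    exact fun z h h' => hne (h.2.2.2.trans h'.2.2.2.symm)
  · rw [Set.disjoint_left]
    rintro z h (h' | h')
    exacts [h.2.2.2.1 h'.2.2.2, h.2.2.2.2 h'.2.2.2]

theorem mem_A0set_iff (hk : 0 < k) {z : GrassVertex F V k} : z ∈ A0set x y ↔
    (Grass F V k).Adj x z ∧ x.1 ⊓ y.1 = z.1 ⊓ y.1 ∧ x.1 ⊔ y.1 = z.1 ⊔ y.1 := by
  refine and_congr_right fun h => ?_
  rw [eq_comm (a := x.1 ⊓ y.1), eq_comm (a := x.1 ⊔ y.1)]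
  exact edgeType0_iff hk h.symm

theorem mem_Apset_iff (hk : 0 < k) {z : GrassVertex F V k} : z ∈ Apset x y ↔
    (Grass F V k).Adj x z ∧ x.1 ⊓ y.1 = z.1 ⊓ y.1 ∧ x.1 ⊔ y.1 ≠ z.1 ⊔ y.1 := by
  refine and_congr_right fun h => ?_
  rw [eq_comm (a := x.1 ⊓ y.1), ne_comm (a := x.1 ⊔ y.1)]
  exact edgeTypeP_iff hk h.symm

theorem inf_ne_and_sup_eq_of_mem_Amset (hk : 0 < k) {z : GrassVertex F V k}
    (h : z ∈ Amset x y) : x.1 ⊓ y.1 ≠ z.1 ⊓ y.1 ∧ x.1 ⊔ y.1 = z.1 ⊔ y.1 := by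
  rw [ne_comm, eq_comm (a := x.1 ⊔ y.1)]
  exact inf_ne_and_sup_eq_of_edgeTypeM hk h.1.symm h.2

end Grassmann

theorem statement18
    (q n k : ℕ) (hq : IsPrimePow q) (hkn : 2 * k < n) (hk : 3 ≤ k)
    (F V : Type) [Field F] [Fintype F] (hcard : Fintype.card F = q)
    [AddCommGroup V] [Module F V] [FiniteDimensional F V]
    (hdim : Module.finrank F V = n)
    [Fintype (Submodule F V)]
    (x y : GrassVertex F V k)
    (i : ℕ) (hi : (Grass F V k).dist x y = i) (hi1 : 1 < i) (hi2 : i < k)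
    (w : GrassVertex F V k) (hw : w ∈ Apset x y) :
    ({z | z ∈ A0set x y ∧ (Grass F V k).Adj w z ∧ EdgeType0 y w z}.ncard : ℚ) = 0 ∧
    ({z | z ∈ A0set x y ∧ (Grass F V k).Adj w z ∧ EdgeTypeP y w z}.ncard : ℚ) = ((q : ℚ) - 1) * gaussQ q i ∧
    ({z | z ∈ A0set x y ∧ (Grass F V k).Adj w z ∧ EdgeTypeM y w z}.ncard : ℚ) = 0 ∧
    ({z | z ∈ Apset x y ∧ (Grass F V k).Adj w z ∧ EdgeType0 y w z}.ncard : ℚ) = ((q : ℚ) - 1) * gaussQ q i ∧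
    ({z | z ∈ Apset x y ∧ (Grass F V k).Adj w z ∧ EdgeTypeP y w z}.ncard : ℚ) = (q : ℚ) * gaussQ q (n - k) - (q : ℚ) ^ i - q ∧
    ({z | z ∈ Apset x y ∧ (Grass F V k).Adj w z ∧ EdgeTypeM y w z}.ncard : ℚ) = 0 ∧
    ({z | z ∈ Amset x y ∧ (Grass F V k).Adj w z ∧ EdgeType0 y w z}.ncard : ℚ) = 0 ∧
    ({z | z ∈ Amset x y ∧ (Grass F V k).Adj w z ∧ EdgeTypeP y w z}.ncard : ℚ) = 0 ∧
    ({z | z ∈ Amset x y ∧ (Grass F V k).Adj w z ∧ EdgeTypeM y w z}.ncard : ℚ) = 0 := by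
  have hk0 : 0 < k := by omega
  have hq1 : 1 < q := hq.one_lt
  have hq1' : (q : ℚ) ≠ 1 := by exact_mod_cast hq1.ne'
  have hq1'' : (q : ℚ) - 1 ≠ 0 := sub_ne_zero.2 hq1'
  have hcardF : Nat.card F = q := by rw [Nat.card_eq_fintype_card, hcard]
  have hd := grass_dist_add_finrank_inf hk0 x y
  rw [hi, add_comm] at hd
  have hT : (x.1 ⊔ w.1) ⊓ y.1 = x.1 ⊓ y.1 := by
    refine sup_inf_eq_of_edgeTypeP ?_
    rw [EdgeTypeP, sup_comm]
    exact ⟨hw.2.2, hw.2.1⟩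
  obtain ⟨hxw, hinf, hne⟩ := (mem_Apset_iff hk0).1 hw
  have c1 := ncard_same_sup hk0 hxw hd hinf hne
  have c2 := ncard_same_sup hk0 hxw.symm (hinf ▸ hd) hinf.symm hne.symm
  have c3 := ncard_ne_sup hk0 hxw hd hinf hne hT
  rw [hcardF] at c1 c2 c3
  rw [hdim] at c3
  have hempty : ∀ p : GrassVertex F V k → Prop, (∀ z, ¬ p z) → ({z | p z}.ncard : ℚ) = 0 := by
    intro p hp
    rw [Set.eq_empty_of_forall_notMem (s := {z | p z}) hp, Set.ncard_empty, Nat.cast_zero]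
  refine ⟨hempty _ ?_, ?_, hempty _ ?_, ?_, ?_, hempty _ ?_, hempty _ ?_, hempty _ ?_, hempty _ ?_⟩
  · rintro z ⟨h1, h2, h3⟩
    rw [mem_A0set_iff hk0] at h1
    rw [edgeType0_iff hk0 h2] at h3
    exact hne (h1.2.2.trans h3.2.symm)
  · have h : {z | z ∈ A0set x y ∧ (Grass F V k).Adj w z ∧ EdgeTypeP y w z} =
        {z | (Grass F V k).Adj x z ∧ (Grass F V k).Adj w z ∧
          x.1 ⊓ y.1 = z.1 ⊓ y.1 ∧ x.1 ⊔ y.1 = z.1 ⊔ y.1} := by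
      ext z
      simp only [Set.mem_ofPred_eq, mem_A0set_iff hk0]
      constructor
      · rintro ⟨⟨h1, h2, h3⟩, h4, -⟩
        exact ⟨h1, h4, h2, h3⟩
      · rintro ⟨h1, h4, h2, h3⟩
        exact ⟨⟨h1, h2, h3⟩, h4, (edgeTypeP_iff hk0 h4).2
          ⟨hinf.symm.trans h2, fun h5 => hne (h3.trans h5.symm)⟩⟩
    rw [h, gaussQ, mul_div_cancel₀ _ hq1'', eq_sub_iff_add_eq]
    exact_mod_cast c1
  · rintro z ⟨h1, h2, h3⟩
    rw [mem_A0set_iff hk0] at h1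
    exact (inf_ne_and_sup_eq_of_edgeTypeM hk0 h2 h3).1 (hinf.symm.trans h1.2.1)
  · have h : {z | z ∈ Apset x y ∧ (Grass F V k).Adj w z ∧ EdgeType0 y w z} =
        {z | (Grass F V k).Adj w z ∧ (Grass F V k).Adj x z ∧
          w.1 ⊓ y.1 = z.1 ⊓ y.1 ∧ w.1 ⊔ y.1 = z.1 ⊔ y.1} := by
      ext z
      simp only [Set.mem_ofPred_eq, mem_Apset_iff hk0]
      constructor
      · rintro ⟨⟨h1, h2, h3⟩, h4, h5⟩
        exact ⟨h4, h1, (edgeType0_iff hk0 h4).1 h5⟩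
      · rintro ⟨h4, h1, h2, h3⟩
        exact ⟨⟨h1, hinf.trans h2, fun h5 => hne (h5.trans h3.symm)⟩, h4,
          (edgeType0_iff hk0 h4).2 ⟨h2, h3⟩⟩
    rw [h, gaussQ, mul_div_cancel₀ _ hq1'', eq_sub_iff_add_eq]
    exact_mod_cast c2
  · have h : {z | z ∈ Apset x y ∧ (Grass F V k).Adj w z ∧ EdgeTypeP y w z} =
        {z | (Grass F V k).Adj x z ∧ (Grass F V k).Adj w z ∧ x.1 ⊓ y.1 = z.1 ⊓ y.1 ∧
          x.1 ⊔ y.1 ≠ z.1 ⊔ y.1 ∧ w.1 ⊔ y.1 ≠ z.1 ⊔ y.1} := by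
      ext z
      simp only [Set.mem_ofPred_eq, mem_Apset_iff hk0]
      constructor
      · rintro ⟨⟨h1, h2, h3⟩, h4, h5⟩
        exact ⟨h1, h4, h2, h3, ((edgeTypeP_iff hk0 h4).1 h5).2⟩
      · rintro ⟨h1, h4, h2, h3, h5⟩
        exact ⟨⟨h1, h2, h3⟩, h4, (edgeTypeP_iff hk0 h4).2 ⟨hinf.symm.trans h2, h5⟩⟩
    rw [h, gaussQ, ← geom_sum_eq hq1', eq_sub_iff_add_eq, eq_sub_iff_add_eq, add_right_comm]
    exact_mod_cast c3
  · rintro z ⟨h1, h2, h3⟩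
    rw [mem_Apset_iff hk0] at h1
    exact (inf_ne_and_sup_eq_of_edgeTypeM hk0 h2 h3).1 (hinf.symm.trans h1.2.1)
  · rintro z ⟨h1, h2, h3⟩
    exact (inf_ne_and_sup_eq_of_mem_Amset hk0 h1).1 (hinf.trans ((edgeType0_iff hk0 h2).1 h3).1)
  · rintro z ⟨h1, h2, h3⟩
    exact (inf_ne_and_sup_eq_of_mem_Amset hk0 h1).1 (hinf.trans ((edgeTypeP_iff hk0 h2).1 h3).1)
  · rintro z ⟨h1, h2, h3⟩
    exact hne ((inf_ne_and_sup_eq_of_mem_Amset hk0 h1).2.trans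
      (inf_ne_and_sup_eq_of_edgeTypeM hk0 h2 h3).2.symm)
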